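/- Let ψ : ℝ² → ℝ be a C³ function that is 2π-periodic in each of its two variables, let F ∈ C¹(ℝ), and suppose Δψ = F(ψ) on ℝ². Assume that every C² function u : ℝ² → ℝ that is 2π-periodic in each variable and satisfies Δu = F'(ψ) u on ℝ² is identically zero. Then ψ is constant; in particular the associated steady Euler velocity u = ∇⊥ψ on the flat two-torus vanishes identically. -/

import Mathlib

open Real

noncomputable def pd1 (f : ℝ × ℝ → ℝ) (q : ℝ × ℝ) : ℝ := fderiv ℝ f q (1, 0)
noncomputable def pd2 (f : ℝ × ℝ → ℝ) (q : ℝ × ℝ) : ℝ := fderiv ℝ f q (0, 1)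
noncomputable def lap (f : ℝ × ℝ → ℝ) (q : ℝ × ℝ) : ℝ := pd1 (pd1 f) q + pd2 (pd2 f) q

/-- Directional derivatives of a `C²` function commute. -/
theorem fderiv_fderiv_apply_comm {E F : Type*} [NormedAddCommGroup E] [NormedSpace ℝ E]
    [NormedAddCommGroup F] [NormedSpace ℝ F] {f : E → F} (hf : ContDiff ℝ 2 f) (v w q : E) :
    fderiv ℝ (fun x => fderiv ℝ f x v) q w = fderiv ℝ (fun x => fderiv ℝ f x w) q v := by
  have hd : DifferentiableAt ℝ (fderiv ℝ f) q :=
    (hf.fderiv_right (m := 1) (by norm_num)).differentiable (by norm_num) q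
  have h := hf.contDiffAt.isSymmSndFDerivAt (x := q) (by simp)
  rw [fderiv_clm_apply hd (differentiableAt_const v),
    fderiv_clm_apply hd (differentiableAt_const w)]
  simpa using h.eq w v

theorem ContDiff.fderiv_apply_const {E F : Type*} [NormedAddCommGroup E] [NormedSpace ℝ E]
    [NormedAddCommGroup F] [NormedSpace ℝ F] {f : E → F} {m n : WithTop ℕ∞}
    (hf : ContDiff ℝ n f) (hmn : m + 1 ≤ n) (v : E) :
    ContDiff ℝ m (fun q => fderiv ℝ f q v) :=
  (hf.fderiv_right hmn).clm_apply contDiff_const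

/-- The derivative of a function with period `c` has period `c`. -/
theorem fderiv_add_period {E F : Type*} [NormedAddCommGroup E] [NormedSpace ℝ E]
    [NormedAddCommGroup F] [NormedSpace ℝ F] {f : E → F} {c : E}
    (h : ∀ q, f (q + c) = f q) (q : E) : fderiv ℝ f (q + c) = fderiv ℝ f q := by
  rw [← fderiv_comp_add_right, funext h]

/-- The Laplacian commutes with directional derivatives of a `C³` function. -/
theorem lap_fderiv_apply {f : ℝ × ℝ → ℝ} (hf : ContDiff ℝ 3 f) (v q : ℝ × ℝ) :
    lap (fun x => fderiv ℝ f x v) q = fderiv ℝ (lap f) q v := by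
  have second (w : ℝ × ℝ) :
      fderiv ℝ (fun x => fderiv ℝ (fun y => fderiv ℝ f y v) x w) q w =
        fderiv ℝ (fun x => fderiv ℝ (fun y => fderiv ℝ f y w) x w) q v := by
    rw [funext fun x => fderiv_fderiv_apply_comm (hf.of_le (by norm_num)) v w x]
    exact fderiv_fderiv_apply_comm (hf.fderiv_apply_const (by norm_num) w) v w q
  have diff (w : ℝ × ℝ) :
      DifferentiableAt ℝ (fun x => fderiv ℝ (fun y => fderiv ℝ f y w) x w) q :=
    ((hf.fderiv_apply_const (m := 2) (by norm_num) w).fderiv_apply_const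
      (m := 1) (by norm_num) w).differentiable (by norm_num) q
  change fderiv ℝ (fun x => fderiv ℝ (fun y => fderiv ℝ f y v) x (1, 0)) q (1, 0) +
      fderiv ℝ (fun x => fderiv ℝ (fun y => fderiv ℝ f y v) x (0, 1)) q (0, 1) =
    fderiv ℝ (fun x => fderiv ℝ (fun y => fderiv ℝ f y (1, 0)) x (1, 0) +
      fderiv ℝ (fun y => fderiv ℝ f y (0, 1)) x (0, 1)) q v
  rw [second, second, fderiv_fun_add (diff _) (diff _), add_apply]

/-- Nonexistence of nonconstant steady states with trivial linearized kernel
on the flat two-torus: if `ψ` is `C³` and doubly `2π`-periodic with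
`Δψ = F(ψ)` and every doubly periodic `C²` solution of `Δu = F'(ψ)u`
vanishes identically, then `ψ` is constant and `u = ∇⊥ψ ≡ 0`. -/
theorem rigidity_torus
    (ψ : ℝ × ℝ → ℝ) (hψ : ContDiff ℝ 3 ψ)
    (hper1 : ∀ q : ℝ × ℝ, ψ (q.1 + 2 * π, q.2) = ψ q)
    (hper2 : ∀ q : ℝ × ℝ, ψ (q.1, q.2 + 2 * π) = ψ q)
    (F : ℝ → ℝ) (hF : ContDiff ℝ 1 F)
    (heq : ∀ q : ℝ × ℝ, lap ψ q = F (ψ q))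
    (hker : ∀ u : ℝ × ℝ → ℝ, ContDiff ℝ 2 u →
      (∀ q : ℝ × ℝ, u (q.1 + 2 * π, q.2) = u q) →
      (∀ q : ℝ × ℝ, u (q.1, q.2 + 2 * π) = u q) →
      (∀ q : ℝ × ℝ, lap u q = deriv F (ψ q) * u q) →
      ∀ q : ℝ × ℝ, u q = 0) :
    (∃ a : ℝ, ∀ q : ℝ × ℝ, ψ q = a) ∧
      ∀ q : ℝ × ℝ, (-(pd2 ψ q), pd1 ψ q) = ((0 : ℝ), (0 : ℝ)) := by
  have hdψ : Differentiable ℝ ψ := hψ.differentiable (by norm_num)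
  have fderiv_zero (q v : ℝ × ℝ) : fderiv ℝ ψ q v = 0 := by
    refine hker (fun x => fderiv ℝ ψ x v) (hψ.fderiv_apply_const (by norm_num) v)
      (fun x => ?_) (fun x => ?_) (fun x => ?_) q
    · have h := fderiv_add_period (f := ψ) (c := (2 * π, 0)) (fun y => by
        simpa [Prod.add_def] using hper1 y) x
      simpa [Prod.add_def] using congrArg (fun L => L v) h
    · have h := fderiv_add_period (f := ψ) (c := (0, 2 * π)) (fun y => by
        simpa [Prod.add_def] using hper2 y) x
      simpa [Prod.add_def] using congrArg (fun L => L v) h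
    · have hFx : HasDerivAt F (deriv F (ψ x)) (ψ x) :=
        (hF.differentiable (by norm_num) (ψ x)).hasDerivAt
      have hcomp : HasFDerivAt (fun y => F (ψ y)) (deriv F (ψ x) • fderiv ℝ ψ x) x :=
        hFx.comp_hasFDerivAt x (hdψ x).hasFDerivAt
      rw [lap_fderiv_apply hψ, funext heq, hcomp.fderiv]
      rfl
  refine ⟨⟨ψ 0, fun q => is_const_of_fderiv_eq_zero hdψ
    (fun x => ContinuousLinearMap.ext (fderiv_zero x)) q 0⟩, fun q => ?_⟩
  simp [pd1, pd2, fderiv_zero]
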